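/- arXiv:1111.0787 — 3 statements merged into one kernel-verified Lean document; each statement's English description precedes it below -/
import Mathlib

section
/- Let d ≥ 1 and let ω : EuclideanSpace ℝ (Fin d) → ℝ≥0∞. Then the critical velocity of the subadditive hull equals that of ω: ⨅_{k ≠ 0} ς_ω(k) / ENNReal.ofReal ‖k‖ = ⨅_{k ≠ 0} ω(k) / ENNReal.ofReal ‖k‖, where both infima are over nonzero k ∈ EuclideanSpace ℝ (Fin d) and are taken in ℝ≥0∞. -/
open scoped ENNReal

/-- The subadditive hull of `ω`: infimum of `ω k₁ + ⋯ + ω kₙ` over all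
decompositions `k = k₁ + ⋯ + kₙ` with `n ≥ 1`. -/
noncomputable def subaddHull {d : ℕ} (ω : EuclideanSpace ℝ (Fin d) → ℝ≥0∞)
    (k : EuclideanSpace ℝ (Fin d)) : ℝ≥0∞ :=
  ⨅ (n : ℕ) (_ : 1 ≤ n) (f : Fin n → EuclideanSpace ℝ (Fin d))
    (_ : ∑ i, f i = k), ∑ i, ω (f i)

/-- The essential subadditive hull of `ω`: the same infimum restricted to
decompositions with `n ≥ 2` terms. -/
noncomputable def essSubaddHull {d : ℕ} (ω : EuclideanSpace ℝ (Fin d) → ℝ≥0∞)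
    (k : EuclideanSpace ℝ (Fin d)) : ℝ≥0∞ :=
  ⨅ (n : ℕ) (_ : 2 ≤ n) (f : Fin n → EuclideanSpace ℝ (Fin d))
    (_ : ∑ i, f i = k), ∑ i, ω (f i)

/-- The hull of `ω` lies below `ω`. -/
theorem subaddHull_le {d : ℕ} (ω : EuclideanSpace ℝ (Fin d) → ℝ≥0∞)
    (k : EuclideanSpace ℝ (Fin d)) : subaddHull ω k ≤ ω k := by
  unfold subaddHull
  refine iInf₂_le_of_le 1 le_rfl (iInf₂_le_of_le (fun _ => k) ?_ ?_) <;> simp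

/-- A linear lower bound on `ω` is inherited by its subadditive hull. -/
theorem mul_norm_le_subaddHull {d : ℕ} {ω : EuclideanSpace ℝ (Fin d) → ℝ≥0∞} {c : ℝ≥0∞}
    (h : ∀ x, c * ENNReal.ofReal ‖x‖ ≤ ω x) (k : EuclideanSpace ℝ (Fin d)) :
    c * ENNReal.ofReal ‖k‖ ≤ subaddHull ω k := by
  unfold subaddHull
  refine le_iInf₂ fun n _ => le_iInf₂ fun f hf => ?_
  calc c * ENNReal.ofReal ‖k‖ ≤ c * ∑ i, ENNReal.ofReal ‖f i‖ := by
        rw [← hf, ← ENNReal.ofReal_sum_of_nonneg fun i _ => norm_nonneg (f i)]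
        gcongr
        exact norm_sum_le _ _
    _ = ∑ i, c * ENNReal.ofReal ‖f i‖ := Finset.mul_sum _ _ _
    _ ≤ ∑ i, ω (f i) := Finset.sum_le_sum fun i _ => h (f i)

/-- The critical velocity of the subadditive hull equals that of `ω`. -/
theorem criticalVelocity_subaddHull_eq {d : ℕ} (hd : 1 ≤ d)
    (ω : EuclideanSpace ℝ (Fin d) → ℝ≥0∞) :
    (⨅ (k : EuclideanSpace ℝ (Fin d)) (_ : k ≠ 0),
        subaddHull ω k / ENNReal.ofReal ‖k‖)
      = ⨅ (k : EuclideanSpace ℝ (Fin d)) (_ : k ≠ 0),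
          ω k / ENNReal.ofReal ‖k‖ := by
  apply le_antisymm
  · exact iInf₂_mono fun k _ => ENNReal.div_le_div_right (subaddHull_le ω k) _
  · refine le_iInf₂ fun k hk => ?_
    have hpos : ENNReal.ofReal ‖k‖ ≠ 0 := by simpa using hk
    rw [ENNReal.le_div_iff_mul_le (.inl hpos) (.inl ENNReal.ofReal_ne_top)]
    refine mul_norm_le_subaddHull (fun x => ?_) k
    by_cases hx : x = 0
    · simp [hx]
    · exact ENNReal.mul_le_of_le_div (iInf₂_le x hx)
end

section
/- Let d ≥ 1 and let ω : EuclideanSpace ℝ (Fin d) → ℝ≥0∞. Then the critical velocity computed from the essential subadditive hull equals that computed from ω: ⨅_{k ≠ 0} ς_{ess,ω}(k) / ENNReal.ofReal ‖k‖ = ⨅_{k ≠ 0} ω(k) / ENNReal.ofReal ‖k‖, where both infima are over nonzero k ∈ EuclideanSpace ℝ (Fin d) and are taken in ℝ≥0∞. -/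
open scoped ENNReal

/-- A lower bound of `ω` by a multiple of the norm passes to the essential subadditive hull. -/
lemma le_essSubaddHull_of_mul_enorm_le {d : ℕ} {ω : EuclideanSpace ℝ (Fin d) → ℝ≥0∞} {c : ℝ≥0∞}
    (h : ∀ k, c * ‖k‖ₑ ≤ ω k) (k : EuclideanSpace ℝ (Fin d)) :
    c * ‖k‖ₑ ≤ essSubaddHull ω k := by
  refine le_iInf fun n => le_iInf fun _ => le_iInf fun f => le_iInf fun hf => ?_
  calc c * ‖k‖ₑ = c * ‖∑ i, f i‖ₑ := by rw [hf]
    _ ≤ c * ∑ i, ‖f i‖ₑ := by gcongr; exact enorm_sum_le _ _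
    _ = ∑ i, c * ‖f i‖ₑ := Finset.mul_sum _ _ _
    _ ≤ ∑ i, ω (f i) := Finset.sum_le_sum fun i _ => h (f i)

lemma essSubaddHull_two_smul_le {d : ℕ} (ω : EuclideanSpace ℝ (Fin d) → ℝ≥0∞)
    (k : EuclideanSpace ℝ (Fin d)) : essSubaddHull ω ((2 : ℝ) • k) ≤ 2 * ω k := by
  refine (iInf₂_le_of_le 2 le_rfl (iInf₂_le (fun _ => k) ?_)).trans_eq ?_
  · simp [two_smul]
  · simp

/-- The critical velocity computed from the essential subadditive hull equals
that computed from `ω`. -/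
theorem criticalVelocity_essSubaddHull_eq {d : ℕ} (hd : 1 ≤ d)
    (ω : EuclideanSpace ℝ (Fin d) → ℝ≥0∞) :
    (⨅ (k : EuclideanSpace ℝ (Fin d)) (_ : k ≠ 0),
        essSubaddHull ω k / ENNReal.ofReal ‖k‖)
      = ⨅ (k : EuclideanSpace ℝ (Fin d)) (_ : k ≠ 0),
          ω k / ENNReal.ofReal ‖k‖ := by
  simp only [ofReal_norm]
  apply le_antisymm
  · refine le_iInf₂ fun k hk => ?_
    refine iInf₂_le_of_le ((2 : ℝ) • k) (smul_ne_zero two_ne_zero hk) ?_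
    calc essSubaddHull ω ((2 : ℝ) • k) / ‖(2 : ℝ) • k‖ₑ
        ≤ 2 * ω k / ‖(2 : ℝ) • k‖ₑ := by
          gcongr
          exact essSubaddHull_two_smul_le ω k
      _ = 2 * ω k / (2 * ‖k‖ₑ) := by
          rw [enorm_smul, Real.enorm_of_nonneg zero_le_two, ENNReal.ofReal_ofNat]
      _ = ω k / ‖k‖ₑ := ENNReal.mul_div_mul_left _ _ two_ne_zero ENNReal.ofNat_ne_top
  · refine le_iInf₂ fun k hk => ?_
    rw [ENNReal.le_div_iff_mul_le (Or.inl (enorm_ne_zero.mpr hk)) (Or.inl enorm_ne_top)]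
    refine le_essSubaddHull_of_mul_enorm_le (fun q => ?_) k
    rcases eq_or_ne q 0 with rfl | hq
    · simp
    · rw [← ENNReal.le_div_iff_mul_le (Or.inl (enorm_ne_zero.mpr hq)) (Or.inl enorm_ne_top)]
      exact iInf₂_le q hq
end

section
/- Let d ≥ 1, let c > 0, a ≥ 0, α > 0 be real numbers, and define ω : EuclideanSpace ℝ (Fin d) → ℝ≥0∞ by ω(k) = ENNReal.ofReal(‖k‖ (1 + a ‖k‖^α)) if ‖k‖ < c, and ω(k) = ∞ otherwise. Then for every k ∈ EuclideanSpace ℝ (Fin d), ς_ω(k) = ENNReal.ofReal ‖k‖ and ς_{ess,ω}(k) = ENNReal.ofReal ‖k‖. (Hence all such dispersion relations yield the same excitation spectrum bottom ε(k) = ε_ess(k) = ‖k‖, showing the dispersion relation is not determined by the excitation spectrum.) -/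
open scoped ENNReal

open Filter Topology

/-- If `ω` dominates the norm, then so does its subadditive hull. -/
theorem ofReal_norm_le_subaddHull {d : ℕ} {ω : EuclideanSpace ℝ (Fin d) → ℝ≥0∞}
    (h : ∀ k, ENNReal.ofReal ‖k‖ ≤ ω k) (k : EuclideanSpace ℝ (Fin d)) :
    ENNReal.ofReal ‖k‖ ≤ subaddHull ω k := by
  refine le_iInf fun n => le_iInf fun _ => le_iInf fun f => le_iInf fun hf => ?_
  calc ENNReal.ofReal ‖k‖ ≤ ENNReal.ofReal (∑ i, ‖f i‖) :=
        ENNReal.ofReal_le_ofReal (hf ▸ norm_sum_le _ _)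
    _ = ∑ i, ENNReal.ofReal ‖f i‖ := ENNReal.ofReal_sum_of_nonneg fun _ _ => norm_nonneg _
    _ ≤ ∑ i, ω (f i) := Finset.sum_le_sum fun i _ => h (f i)

theorem subaddHull_le_essSubaddHull {d : ℕ} (ω : EuclideanSpace ℝ (Fin d) → ℝ≥0∞)
    (k : EuclideanSpace ℝ (Fin d)) : subaddHull ω k ≤ essSubaddHull ω k :=
  iInf_mono fun _ => iInf_mono' fun hn => ⟨by omega, le_rfl⟩

/-- The decomposition of `k` into `n ≥ 2` equal parts bounds the essential subadditive hull. -/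
theorem essSubaddHull_le_nsmul {d : ℕ} (ω : EuclideanSpace ℝ (Fin d) → ℝ≥0∞)
    (k : EuclideanSpace ℝ (Fin d)) {n : ℕ} (hn : 2 ≤ n) :
    essSubaddHull ω k ≤ n * ω ((n : ℝ)⁻¹ • k) := by
  have hn0 : (n : ℝ) ≠ 0 := by positivity
  have hsum : ∑ _i : Fin n, (n : ℝ)⁻¹ • k = k := by
    rw [Finset.sum_const, Finset.card_univ, Fintype.card_fin, ← Nat.cast_smul_eq_nsmul ℝ,
      smul_inv_smul₀ hn0]
  calc essSubaddHull ω k ≤ ∑ _i : Fin n, ω ((n : ℝ)⁻¹ • k) :=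
        iInf₂_le_of_le n hn (iInf₂_le (fun _ : Fin n => (n : ℝ)⁻¹ • k) hsum)
    _ = n * ω ((n : ℝ)⁻¹ • k) := by simp

/-- All dispersion relations `ω(k) = ‖k‖(1 + a‖k‖^α)` for `‖k‖ < c` (and `∞`
otherwise) have the same subadditive hull and essential subadditive hull,
both equal to `‖k‖`. -/
theorem subaddHull_of_modified_linear {d : ℕ} (hd : 1 ≤ d)
    (c a α : ℝ) (hc : 0 < c) (ha : 0 ≤ a) (hα : 0 < α)
    (ω : EuclideanSpace ℝ (Fin d) → ℝ≥0∞)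
    (hω : ∀ k : EuclideanSpace ℝ (Fin d),
      ω k = if ‖k‖ < c then ENNReal.ofReal (‖k‖ * (1 + a * ‖k‖ ^ α)) else ∞) :
    ∀ k : EuclideanSpace ℝ (Fin d),
      subaddHull ω k = ENNReal.ofReal ‖k‖ ∧
      essSubaddHull ω k = ENNReal.ofReal ‖k‖ := by
  intro k
  have hlow : ENNReal.ofReal ‖k‖ ≤ subaddHull ω k := by
    refine ofReal_norm_le_subaddHull (fun q => ?_) k
    rw [hω]
    split_ifs
    · exact ENNReal.ofReal_le_ofReal
        (le_mul_of_one_le_right (norm_nonneg q) (le_add_of_nonneg_right (by positivity)))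
    · exact le_top
  have hsmall : Tendsto (fun n : ℕ => (n : ℝ)⁻¹ * ‖k‖) atTop (𝓝 0) := by
    simpa using (tendsto_inv_atTop_nhds_zero_nat (𝕜 := ℝ)).mul_const ‖k‖
  have hlim : Tendsto (fun n : ℕ => ENNReal.ofReal (‖k‖ * (1 + a * ((n : ℝ)⁻¹ * ‖k‖) ^ α)))
      atTop (𝓝 (ENNReal.ofReal ‖k‖)) := by
    refine ENNReal.tendsto_ofReal ?_
    have h := ((hsmall.rpow_const (Or.inr hα.le)).const_mul a).const_add 1 |>.const_mul ‖k‖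
    simpa [Real.zero_rpow hα.ne'] using h
  have hupp : essSubaddHull ω k ≤ ENNReal.ofReal ‖k‖ := by
    refine ge_of_tendsto hlim ?_
    filter_upwards [hsmall.eventually_lt_const hc, eventually_ge_atTop 2] with n hn hn2
    have hn0 : (n : ℝ) ≠ 0 := by positivity
    have hnorm : ‖(n : ℝ)⁻¹ • k‖ = (n : ℝ)⁻¹ * ‖k‖ := by simp [norm_smul]
    refine (essSubaddHull_le_nsmul ω k hn2).trans_eq ?_
    rw [hω, hnorm, if_pos hn, ← ENNReal.ofReal_natCast n,
      ← ENNReal.ofReal_mul (Nat.cast_nonneg n), ← mul_assoc, mul_inv_cancel_left₀ hn0]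
  have hle := subaddHull_le_essSubaddHull ω k
  exact ⟨(hle.trans hupp).antisymm hlow, hupp.antisymm (hlow.trans hle)⟩
end
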